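/- Let P > 0, M > 0, r > 0, r_u ≥ 0 with r ≠ r_u, and v ∈ [2, 6]. Define I₀ = (1/(2π)) ∫_{−π}^{π} (r² + r_u² − 2 r r_u cos α)^{−v/2} dα, R_asy = log₂(1 + P M I₀), R^{B,1} = log₂(1 + P M (r_u² + r²)^{v/2 − 1} / |r_u² − r²|^{v − 1}), and R^{B,2} = log₂(1 + P M · (2^{3(v/2−1)} Γ(v/2 − 1/2)² / (π Γ(v − 1))) · (r_u² + r²)^{v/2 − 1} / |r_u² − r²|^{v − 1}). Then: if 2 ≤ v ≤ 4, R^{B,2} ≤ R_asy ≤ R^{B,1}; if 4 ≤ v ≤ 6, R^{B,1} ≤ R_asy ≤ R^{B,2}; and if v = 2 or v = 4, R_asy = R^{B,1} = R^{B,2}. -/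

import Mathlib

open Real

lemma aux_pos {a b : ℝ} (hb : 0 ≤ b) (hab : b < a) (x : ℝ) :
    0 < a ^ 2 + b ^ 2 - 2 * a * b * cos x ∧ 0 < a ^ 2 + b ^ 2 + 2 * a * b * cos x ∧
      0 < a + b * cos x := by
  have h1 := neg_one_le_cos x
  have h2 := cos_le_one x
  have hc : 0 ≤ a * b := by nlinarith
  have hd : 0 < (a - b) ^ 2 := by have : 0 < a - b := by linarith
                                  positivity
  refine ⟨by nlinarith, by nlinarith, by nlinarith⟩

lemma aux_deriv {a b : ℝ} (hb : 0 ≤ b) (hab : b < a) (x : ℝ) :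
    HasDerivAt (fun x => x - 2 * arctan (b * sin x / (a + b * cos x)))
      ((a ^ 2 - b ^ 2) / (a ^ 2 + b ^ 2 + 2 * a * b * cos x)) x := by
  obtain ⟨-, h2, h3⟩ := aux_pos hb hab x
  have hN : HasDerivAt (fun x => b * sin x) (b * cos x) x := (hasDerivAt_sin x).const_mul b
  have hD : HasDerivAt (fun x => a + b * cos x) (b * (-sin x)) x :=
    ((hasDerivAt_cos x).const_mul b).const_add a
  have := (hasDerivAt_id' x).sub (((hN.div hD h3.ne').arctan).const_mul 2)
  refine this.congr_deriv ?_
  have hs : sin x ^ 2 = 1 - cos x ^ 2 := by rw [← sin_sq_add_cos_sq x]; ring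
  have e : 1 + (b * sin x / (a + b * cos x)) ^ 2
      = (a ^ 2 + b ^ 2 + 2 * a * b * cos x) / (a + b * cos x) ^ 2 := by
    rw [div_pow, mul_pow, hs]; field_simp; ring
  simp only [Pi.div_apply]
  rw [e]
  field_simp
  linear_combination (-2 * b ^ 2) * hs

lemma aux_cos {a b : ℝ} (hb : 0 ≤ b) (hab : b < a) (x : ℝ) :
    a ^ 2 + b ^ 2 - 2 * a * b * cos (x - 2 * arctan (b * sin x / (a + b * cos x)))
      = (a ^ 2 - b ^ 2) ^ 2 / (a ^ 2 + b ^ 2 + 2 * a * b * cos x) := by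
  obtain ⟨-, h2, h3⟩ := aux_pos hb hab x
  have hs : sin x ^ 2 = 1 - cos x ^ 2 := by rw [← sin_sq_add_cos_sq x]; ring
  set y := b * sin x / (a + b * cos x) with hy
  have e : 1 + y ^ 2
      = (a ^ 2 + b ^ 2 + 2 * a * b * cos x) / (a + b * cos x) ^ 2 := by
    rw [hy, div_pow, mul_pow, hs]; field_simp; ring
  have hc2 := cos_sq_arctan y
  have hsc : sin (arctan y) = y * cos (arctan y) := by
    have := tan_arctan y
    rw [tan_eq_sin_div_cos, div_eq_iff (cos_arctan_pos y).ne'] at this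
    exact this
  have c1 : cos (2 * arctan y) = 2 / (1 + y ^ 2) - 1 := by
    rw [cos_two_mul, hc2]; ring
  have s1 : sin (2 * arctan y) = 2 * y / (1 + y ^ 2) := by
    rw [sin_two_mul, hsc]
    linear_combination (2 * y) * hc2
  rw [cos_sub, c1, s1, e, hy]
  clear_value y
  generalize hE : a ^ 2 + b ^ 2 + 2 * a * b * cos x = E at *
  generalize hw : a + b * cos x = w at *
  have hE0 := h2.ne'
  have hw0 := h3.ne'
  field_simp
  subst hw
  subst hE
  linear_combination (-4 * a * b^2 * (a + b * cos x)) * hs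

lemma aux_int {a b : ℝ} (hb : 0 ≤ b) (hab : b < a) (s : ℝ) :
    ∫ α in (-π)..π, (a ^ 2 + b ^ 2 - 2 * a * b * cos α) ^ (-s)
      = (a ^ 2 - b ^ 2) ^ (1 - 2 * s) *
        ∫ α in (-π)..π, (a ^ 2 + b ^ 2 + 2 * a * b * cos α) ^ (s - 1) := by
  have hD : 0 < a ^ 2 - b ^ 2 := by nlinarith
  have key := intervalIntegral.integral_comp_mul_deriv (a := -π) (b := π)
    (f := fun x => x - 2 * arctan (b * sin x / (a + b * cos x)))
    (f' := fun x => (a ^ 2 - b ^ 2) / (a ^ 2 + b ^ 2 + 2 * a * b * cos x))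
    (g := fun α => (a ^ 2 + b ^ 2 - 2 * a * b * cos α) ^ (-s))
    (fun x _ => aux_deriv hb hab x)
    (Continuous.continuousOn (by
      refine Continuous.div (by fun_prop) (by fun_prop) (fun x => (aux_pos hb hab x).2.1.ne')))
    (by
      refine Continuous.rpow_const (by fun_prop) (fun x => Or.inl (aux_pos hb hab x).1.ne'))
  simp only [sin_neg, sin_pi, neg_zero, mul_zero, zero_div, arctan_zero, sub_zero] at key
  rw [← key, ← intervalIntegral.integral_const_mul]
  refine intervalIntegral.integral_congr (fun x _ => ?_)
  obtain ⟨-, h2, -⟩ := aux_pos hb hab x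
  simp only [Function.comp]
  rw [aux_cos hb hab x, div_rpow (by positivity) h2.le, rpow_neg h2.le, rpow_sub_one h2.ne',
    ← rpow_natCast, ← rpow_mul hD.le, sub_eq_add_neg 1, rpow_add hD, rpow_one]
  have : ((2 : ℕ) : ℝ) * -s = -(2 * s) := by push_cast; ring
  rw [this]
  have := (rpow_pos_of_pos h2 s).ne'
  field_simp

lemma aux_beta {p q : ℝ} (hp : 0 < p) (hq : 0 < q) :
    ∫ x in (0:ℝ)..1, x ^ (p - 1) * (1 - x) ^ (q - 1) = Gamma p * Gamma q / Gamma (p + q) := by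
  have h := Complex.betaIntegral_eq_Gamma_mul_div (p : ℂ) (q : ℂ) (by simpa) (by simpa)
  rw [Complex.betaIntegral, ← Complex.ofReal_add, Complex.Gamma_ofReal, Complex.Gamma_ofReal,
    Complex.Gamma_ofReal] at h
  rw [← Complex.ofReal_inj, ← intervalIntegral.integral_ofReal]
  push_cast
  rw [← h]
  refine intervalIntegral.integral_congr (fun x hx => ?_)
  rw [Set.uIcc_of_le zero_le_one] at hx
  rw [Complex.ofReal_cpow hx.1, Complex.ofReal_cpow (by linarith [hx.2])]
  push_cast
  rfl

lemma aux_K {n : ℝ} (hn : 0 ≤ n) :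
    ∫ x in (0:ℝ)..π, (1 - cos x) ^ n
      = π * (2 ^ (3 * n) * Gamma (n + 1 / 2) ^ 2 / (π * Gamma (2 * n + 1))) := by
  have h1 : ∫ x in (0:ℝ)..π, (1 - cos x) ^ n
      = 2 ^ n * ∫ x in (0:ℝ)..1, x ^ ((n + 1 / 2) - 1) * (1 - x) ^ ((1/2 : ℝ) - 1) := by
    have key := intervalIntegral.integral_comp_mul_deriv_of_deriv_nonneg (a := 0) (b := π)
      (f := fun x => (1 - cos x) / 2) (f' := fun x => sin x / 2)
      (g := fun x => x ^ ((n + 1 / 2) - 1) * (1 - x) ^ ((1/2 : ℝ) - 1))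
      (Continuous.continuousOn (by fun_prop))
      (fun x _ => by
        have := (((hasDerivAt_cos x).const_sub 1).div_const 2)
        exact (this.congr_deriv (by ring)))
      (fun x hx => by
        rw [min_eq_left pi_pos.le, max_eq_right pi_pos.le] at hx
        have := sin_pos_of_mem_Ioo hx
        positivity)
    simp only [cos_zero, sub_self, zero_div, cos_pi, sub_neg_eq_add, one_add_one_eq_two,
      div_self (two_ne_zero' ℝ)] at key
    rw [← key, ← intervalIntegral.integral_const_mul]
    refine intervalIntegral.integral_congr_uIoo (fun x hx => ?_)
    rw [Set.uIoo_of_le pi_pos.le] at hx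
    have hs := sin_pos_of_mem_Ioo hx
    simp only [Function.comp]
    set u := (1 - cos x) / 2 with hu
    have hss := sin_sq_add_cos_sq x
    have hu4 : u * (1 - u) = (sin x / 2) ^ 2 := by rw [hu]; linear_combination (-1/4) * hss
    have hu0 : 0 < u := by
      have := cos_le_one x
      have h0 : 0 ≤ u := by rw [hu]; linarith
      rcases h0.lt_or_eq with h | h
      · exact h
      · rw [← h] at hu4; nlinarith
    have hu1 : 0 < 1 - u := by
      by_contra hc
      nlinarith
    have e1 : 1 - cos x = 2 * u := by rw [hu]; ring
    rw [e1, mul_rpow (by norm_num) hu0.le]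
    have e2 : n + 1/2 - 1 = n + (-(1/2)) := by ring
    have e3 : (1/2:ℝ) - 1 = -(1/2) := by ring
    have e4 : u ^ (-(1/2) : ℝ) * (1 - u) ^ (-(1/2) : ℝ) = (sin x / 2)⁻¹ := by
      rw [← mul_rpow hu0.le hu1.le, hu4, rpow_neg (by positivity), ← sqrt_eq_rpow,
        sqrt_sq (by positivity)]
    rw [e2, e3, rpow_add hu0, mul_assoc (u ^ n), e4, mul_assoc, inv_mul_cancel₀ (by positivity),
      mul_one]
  have hG1 : 0 < Gamma (n + 1/2) := Gamma_pos_of_pos (by linarith)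
  have hG2 : 0 < Gamma (n + 1) := Gamma_pos_of_pos (by linarith)
  have hG3 : 0 < Gamma (2 * n + 1) := Gamma_pos_of_pos (by linarith)
  have hdup := Gamma_mul_Gamma_add_half (n + 1/2)
  have f1 : n + 1/2 + 1/2 = n + 1 := by ring
  have f2 : 2 * (n + 1/2) = 2 * n + 1 := by ring
  have f3 : 1 - (2 * n + 1) = -(2 * n) := by ring
  rw [f1, f2, f3, rpow_neg (by norm_num)] at hdup
  have f4 : (2:ℝ) ^ (3 * n) = 2 ^ n * 2 ^ (2 * n) := by
    rw [← rpow_add (by norm_num)]; congr 1; ring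
  rw [h1, aux_beta (by linarith) (by norm_num), f1, Gamma_one_half_eq, f4]
  have hp : (0:ℝ) < 2 ^ (2 * n) := by positivity
  have hpi := pi_pos
  field_simp at hdup ⊢
  linear_combination (-1) * hdup

lemma aux_K2 {n : ℝ} (hn : 0 ≤ n) :
    (∫ x in (-π)..π, (1 - cos x) ^ n) = 2 * ∫ x in (0:ℝ)..π, (1 - cos x) ^ n := by
  have hc : Continuous (fun x : ℝ => (1 - cos x) ^ n) :=
    Continuous.rpow_const (by fun_prop) (fun x => Or.inr hn)
  rw [← intervalIntegral.integral_add_adjacent_intervals (hc.intervalIntegrable (-π) 0)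
    (hc.intervalIntegrable 0 π)]
  have := intervalIntegral.integral_comp_neg (a := 0) (b := π) (fun x : ℝ => (1 - cos x) ^ n)
  simp only [cos_neg, neg_zero] at this
  rw [← this]; ring

lemma aux_K3 {n : ℝ} (hn : 0 ≤ n) :
    (∫ x in (-π)..π, (1 + cos x) ^ n) = 2 * ∫ x in (0:ℝ)..π, (1 - cos x) ^ n := by
  have hc : Continuous (fun x : ℝ => (1 + cos x) ^ n) :=
    Continuous.rpow_const (by fun_prop) (fun x => Or.inr hn)
  rw [← intervalIntegral.integral_add_adjacent_intervals (hc.intervalIntegrable (-π) 0)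
    (hc.intervalIntegrable 0 π)]
  have := intervalIntegral.integral_comp_neg (a := 0) (b := π) (fun x : ℝ => (1 + cos x) ^ n)
  simp only [cos_neg, neg_zero] at this
  have h2 := intervalIntegral.integral_comp_sub_left (a := 0) (b := π)
    (fun x : ℝ => (1 + cos x) ^ n) π
  simp only [cos_pi_sub, sub_self, sub_zero, ← sub_eq_add_neg] at h2
  rw [← this, h2]; ring

section
variable {t n : ℝ}

lemma aux_t (ht0 : 0 ≤ t) (ht1 : t ≤ 1) (x : ℝ) : -1 ≤ t * cos x := by
  nlinarith [neg_one_le_cos x, cos_le_one x]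

lemma aux_cont (hn : 0 ≤ n) (t : ℝ) : Continuous (fun x : ℝ => (1 + t * cos x) ^ n) :=
  Continuous.rpow_const (by fun_prop) (fun x => Or.inr hn)

lemma aux_lin (t n : ℝ) : ∫ x in (-π)..π, (1 + n * (t * cos x)) = 2 * π := by
  rw [intervalIntegral.integral_add (by simp)
    (Continuous.intervalIntegrable (by fun_prop) _ _)]
  simp
  ring

lemma aux_comb (hn : 0 ≤ n) (t : ℝ) :
    ∫ x in (-π)..π, ((1 + t) / 2 * (1 + cos x) ^ n + (1 - t) / 2 * (1 - cos x) ^ n)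
      = 2 * ∫ x in (0:ℝ)..π, (1 - cos x) ^ n := by
  have hc1 : Continuous (fun x : ℝ => (1 + cos x) ^ n) :=
    Continuous.rpow_const (by fun_prop) (fun x => Or.inr hn)
  have hc2 : Continuous (fun x : ℝ => (1 - cos x) ^ n) :=
    Continuous.rpow_const (by fun_prop) (fun x => Or.inr hn)
  rw [intervalIntegral.integral_add (Continuous.intervalIntegrable (by fun_prop) _ _)
    (Continuous.intervalIntegrable (by fun_prop) _ _), intervalIntegral.integral_const_mul,
    intervalIntegral.integral_const_mul, aux_K2 hn, aux_K3 hn]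
  ring

lemma aux_comb_cont (hn : 0 ≤ n) (t : ℝ) :
    Continuous (fun x : ℝ => (1 + t) / 2 * (1 + cos x) ^ n + (1 - t) / 2 * (1 - cos x) ^ n) := by
  have hc1 : Continuous (fun x : ℝ => (1 + cos x) ^ n) :=
    Continuous.rpow_const (by fun_prop) (fun x => Or.inr hn)
  have hc2 : Continuous (fun x : ℝ => (1 - cos x) ^ n) :=
    Continuous.rpow_const (by fun_prop) (fun x => Or.inr hn)
  fun_prop

lemma aux_low (ht0 : 0 ≤ t) (ht1 : t ≤ 1) (hn : 0 ≤ n) (hn1 : n ≤ 1) :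
    2 * (∫ x in (0:ℝ)..π, (1 - cos x) ^ n) ≤ ∫ x in (-π)..π, (1 + t * cos x) ^ n ∧
    ∫ x in (-π)..π, (1 + t * cos x) ^ n ≤ 2 * π := by
  constructor
  · rw [← aux_comb hn t]
    refine intervalIntegral.integral_mono (by linarith [pi_pos])
      ((aux_comb_cont hn t).intervalIntegrable _ _) ((aux_cont hn t).intervalIntegrable _ _)
      (fun x => ?_)
    have := (concaveOn_rpow hn hn1).2
      (show 1 + cos x ∈ Set.Ici 0 by simp; linarith [neg_one_le_cos x])
      (show 1 - cos x ∈ Set.Ici 0 by simp; linarith [cos_le_one x])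
      (show 0 ≤ (1 + t) / 2 by linarith) (show 0 ≤ (1 - t) / 2 by linarith) (by ring)
    simp only [smul_eq_mul] at this
    refine this.trans (le_of_eq ?_)
    congr 1; ring
  · rw [← aux_lin t n]
    exact intervalIntegral.integral_mono (by linarith [pi_pos])
      ((aux_cont hn t).intervalIntegrable _ _)
      (Continuous.intervalIntegrable (by fun_prop) _ _)
      (fun x => rpow_one_add_le_one_add_mul_self (aux_t ht0 ht1 x) hn hn1)

lemma aux_high (ht0 : 0 ≤ t) (ht1 : t ≤ 1) (hn1 : 1 ≤ n) :
    ∫ x in (-π)..π, (1 + t * cos x) ^ n ≤ 2 * (∫ x in (0:ℝ)..π, (1 - cos x) ^ n) ∧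
    2 * π ≤ ∫ x in (-π)..π, (1 + t * cos x) ^ n := by
  have hn : 0 ≤ n := by linarith
  constructor
  · rw [← aux_comb hn t]
    refine intervalIntegral.integral_mono (by linarith [pi_pos])
      ((aux_cont hn t).intervalIntegrable _ _) ((aux_comb_cont hn t).intervalIntegrable _ _)
      (fun x => ?_)
    have := (convexOn_rpow hn1).2
      (show 1 + cos x ∈ Set.Ici 0 by simp; linarith [neg_one_le_cos x])
      (show 1 - cos x ∈ Set.Ici 0 by simp; linarith [cos_le_one x])
      (show 0 ≤ (1 + t) / 2 by linarith) (show 0 ≤ (1 - t) / 2 by linarith) (by ring)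
    simp only [smul_eq_mul] at this
    refine (le_of_eq ?_).trans this
    simp only
    congr 1; ring
  · rw [← aux_lin t n]
    exact intervalIntegral.integral_mono (by linarith [pi_pos])
      (Continuous.intervalIntegrable (by fun_prop) _ _)
      ((aux_cont hn t).intervalIntegrable _ _)
      (fun x => one_add_mul_self_le_rpow_one_add (aux_t ht0 ht1 x) hn1)

end

lemma aux_I0' {a b n : ℝ} (hb : 0 ≤ b) (hab : b < a) :
    ∃ t, 0 ≤ t ∧ t ≤ 1 ∧
    (1 / (2 * π)) * ∫ α in (-π)..π, (a ^ 2 + b ^ 2 - 2 * a * b * cos α) ^ (-(n + 1))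
      = (a ^ 2 + b ^ 2) ^ n / (a ^ 2 - b ^ 2) ^ (2 * n + 1) *
        ((∫ x in (-π)..π, (1 + t * cos x) ^ n) / (2 * π)) := by
  have ha : 0 < a := by linarith
  have hA : 0 < a ^ 2 + b ^ 2 := by positivity
  have hD : 0 < a ^ 2 - b ^ 2 := by nlinarith
  have ht0 : 0 ≤ 2 * a * b / (a ^ 2 + b ^ 2) := by positivity
  have ht1 : 2 * a * b / (a ^ 2 + b ^ 2) ≤ 1 := by
    rw [div_le_one hA]; nlinarith [sq_nonneg (a - b)]
  refine ⟨2 * a * b / (a ^ 2 + b ^ 2), ht0, ht1, ?_⟩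
  have e : ∀ x, (a ^ 2 + b ^ 2 + 2 * a * b * cos x) ^ (n + 1 - 1)
      = (a ^ 2 + b ^ 2) ^ n * (1 + 2 * a * b / (a ^ 2 + b ^ 2) * cos x) ^ n := by
    intro x
    rw [← mul_rpow hA.le (by linarith [aux_t ht0 ht1 x]), add_sub_cancel_right]
    congr 1
    field_simp
  rw [aux_int hb hab]
  simp_rw [e]
  rw [intervalIntegral.integral_const_mul]
  have : 1 - 2 * (n + 1) = -(2 * n + 1) := by ring
  rw [this, rpow_neg hD.le]
  field_simp

lemma aux_I0 {r ru n : ℝ} (hr : 0 < r) (hru : 0 ≤ ru) (hne : r ≠ ru) :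
    ∃ t, 0 ≤ t ∧ t ≤ 1 ∧
    (1 / (2 * π)) * ∫ α in (-π)..π, (r ^ 2 + ru ^ 2 - 2 * r * ru * cos α) ^ (-(n + 1))
      = (ru ^ 2 + r ^ 2) ^ n / |ru ^ 2 - r ^ 2| ^ (2 * n + 1) *
        ((∫ x in (-π)..π, (1 + t * cos x) ^ n) / (2 * π)) := by
  rcases lt_or_gt_of_ne hne with h | h
  · have hD : 0 < ru ^ 2 - r ^ 2 := by nlinarith
    obtain ⟨t, h0, h1, h2⟩ := aux_I0' (n := n) hr.le h
    refine ⟨t, h0, h1, ?_⟩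
    rw [abs_of_pos hD, ← h2]
    simp only [add_comm (r ^ 2), mul_right_comm 2 r ru]
  · have hD : ru ^ 2 - r ^ 2 < 0 := by nlinarith
    obtain ⟨t, h0, h1, h2⟩ := aux_I0' (n := n) hru h
    refine ⟨t, h0, h1, ?_⟩
    rw [abs_of_neg hD, h2, add_comm (ru ^ 2), neg_sub]

/-- Theorem 4: closed-form bounds on the asymptotic achievable rate
`R_asy = log₂(1 + P M I₀)` of a user at distance `r_u` from the center of a circular
antenna array of radius `r`, where `I₀` is the asymptotic mean path-loss. For
path-loss exponent `2 ≤ v ≤ 4`, `R^{B,2} ≤ R_asy ≤ R^{B,1}`; for `4 ≤ v ≤ 6`,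
`R^{B,1} ≤ R_asy ≤ R^{B,2}`; and for `v = 2` or `v = 4` all three coincide. -/
theorem stmt_13 (P M r ru v : ℝ) (hP : 0 < P) (hM : 0 < M)
    (hr : 0 < r) (hru : 0 ≤ ru) (hne : r ≠ ru) (hv2 : 2 ≤ v) (hv6 : v ≤ 6)
    (I0 Rasy RB1 RB2 : ℝ)
    (hI0 : I0 = (1 / (2 * π)) *
      ∫ α in (-π)..π, (r ^ 2 + ru ^ 2 - 2 * r * ru * Real.cos α) ^ (-(v / 2)))
    (hRasy : Rasy = Real.logb 2 (1 + P * M * I0))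
    (hRB1 : RB1 = Real.logb 2
      (1 + P * M * (ru ^ 2 + r ^ 2) ^ (v / 2 - 1) / |ru ^ 2 - r ^ 2| ^ (v - 1)))
    (hRB2 : RB2 = Real.logb 2
      (1 + P * M *
        (2 ^ (3 * (v / 2 - 1)) * Real.Gamma (v / 2 - 1 / 2) ^ 2 /
          (π * Real.Gamma (v - 1))) *
        (ru ^ 2 + r ^ 2) ^ (v / 2 - 1) / |ru ^ 2 - r ^ 2| ^ (v - 1))) :
    (v ≤ 4 → RB2 ≤ Rasy ∧ Rasy ≤ RB1) ∧
    (4 ≤ v → RB1 ≤ Rasy ∧ Rasy ≤ RB2) ∧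
    (v = 2 ∨ v = 4 → Rasy = RB1 ∧ RB1 = RB2) := by
  obtain ⟨n, rfl⟩ : ∃ n, v = 2 * n + 2 := ⟨v / 2 - 1, by ring⟩
  have hn : 0 ≤ n := by linarith
  have g1 : (2 * n + 2) / 2 = n + 1 := by ring
  have g2 : n + 1 - 1 = n := by ring
  have g3 : 2 * n + 2 - 1 = 2 * n + 1 := by ring
  have g4 : n + 1 - 1 / 2 = n + 1 / 2 := by ring
  rw [g1] at hI0
  rw [g1, g2, g3] at hRB1
  rw [g1, g2, g3, g4] at hRB2
  obtain ⟨t, ht0, ht1, hI⟩ := aux_I0 (n := n) hr hru hne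
  rw [hI] at hI0
  have hK := aux_K hn
  set K := ∫ x in (0:ℝ)..π, (1 - cos x) ^ n with hKdef
  set J := ∫ x in (-π)..π, (1 + t * cos x) ^ n with hJdef
  set C := 2 ^ (3 * n) * Gamma (n + 1 / 2) ^ 2 / (π * Gamma (2 * n + 1)) with hC
  have hD : 0 < |ru ^ 2 - r ^ 2| := by
    rw [abs_pos]
    intro h
    have : (ru - r) * (ru + r) = 0 := by linear_combination h
    rcases mul_eq_zero.mp this with h | h
    · exact hne (by linarith)
    · linarith
  set Q := (ru ^ 2 + r ^ 2) ^ n / |ru ^ 2 - r ^ 2| ^ (2 * n + 1) with hQ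
  have hQ0 : 0 < Q := by positivity
  have hpi := pi_pos
  have hCpos : 0 < C := by
    have : 0 < Gamma (n + 1/2) := Gamma_pos_of_pos (by linarith)
    have : 0 < Gamma (2 * n + 1) := Gamma_pos_of_pos (by linarith)
    positivity
  have hJ0 : 0 ≤ J / (2 * π) := by
    refine div_nonneg (intervalIntegral.integral_nonneg (by linarith) (fun x _ => ?_))
      (by positivity)
    exact rpow_nonneg (by linarith [aux_t ht0 ht1 x]) _
  have mono : ∀ {x y : ℝ}, 0 ≤ x → x ≤ y →
      logb 2 (1 + P * M * Q * x) ≤ logb 2 (1 + P * M * Q * y) := by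
    intro x y hx hxy
    apply logb_le_logb_of_le (by norm_num) (by positivity)
    gcongr
  have r0 : Rasy = logb 2 (1 + P * M * Q * (J / (2 * π))) := by
    rw [hRasy, hI0]; congr 2; ring
  have r1 : RB1 = logb 2 (1 + P * M * Q * 1) := by
    rw [hRB1, hQ]; congr 2; ring
  have r2 : RB2 = logb 2 (1 + P * M * Q * C) := by
    rw [hRB2, hQ]; congr 2; ring
  have low : n ≤ 1 → C ≤ J / (2 * π) ∧ J / (2 * π) ≤ 1 := by
    intro h
    obtain ⟨h1, h2⟩ := aux_low ht0 ht1 hn h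
    rw [le_div_iff₀ (by positivity), div_le_one (by positivity)]
    exact ⟨by rw [← hKdef, hK] at h1; linarith, h2⟩
  have high : 1 ≤ n → 1 ≤ J / (2 * π) ∧ J / (2 * π) ≤ C := by
    intro h
    obtain ⟨h1, h2⟩ := aux_high ht0 ht1 h
    rw [div_le_iff₀ (by positivity), one_le_div (by positivity)]
    exact ⟨h2, by rw [← hKdef, hK] at h1; linarith⟩
  have p1 : 2 * n + 2 ≤ 4 → RB2 ≤ Rasy ∧ Rasy ≤ RB1 := by
    intro h
    obtain ⟨h1, h2⟩ := low (by linarith)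
    rw [r0, r1, r2]
    exact ⟨mono hCpos.le h1, mono hJ0 h2⟩
  have p2 : 4 ≤ 2 * n + 2 → RB1 ≤ Rasy ∧ Rasy ≤ RB2 := by
    intro h
    obtain ⟨h1, h2⟩ := high (by linarith)
    rw [r0, r1, r2]
    exact ⟨mono zero_le_one h1, mono hJ0 h2⟩
  refine ⟨p1, p2, ?_⟩
  rintro (h | h)
  · have hn0 : n = 0 := by linarith
    have hC1 : C = 1 := by
      have : K = π := by rw [hKdef, hn0]; simp
      rw [this] at hK
      exact (mul_left_cancel₀ hpi.ne' (by linarith))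
    obtain ⟨h1, h2⟩ := p1 (by linarith)
    have : RB1 = RB2 := by rw [r1, r2, hC1]
    exact ⟨by linarith, this⟩
  · obtain ⟨h1, h2⟩ := p1 (by linarith)
    obtain ⟨h3, h4⟩ := p2 (by linarith)
    exact ⟨by linarith, by linarith⟩
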